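/- For every d ≥ 0, let p = acdbecd · g(24) · g(f(24)) · … · g(f^d(24)) and let s = g(f^d(0)) · g(f^{d-1}(01240)) · g(f^{d-2}(01240)) · … · g(f(01240)) · g(01240) · abcdbecde (where the product of g(f^k(01240)) terms is empty when d = 0). Then the word T = p·s is a conjugate of g(f^d(0324)) and T is not a factor of w₅ = G(F^ω(0)). -/

import Mathlib

/-- The morphism F on the alphabet Σ = {0,1,2,3,4}. -/
def F : Fin 5 → List (Fin 5)
  | 0 => [0, 1]
  | 1 => [2]
  | 2 => [0, 3]
  | 3 => [2, 4]
  | 4 => [2, 3]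

/-- Extension of F to words. -/
def Fw (w : List (Fin 5)) : List (Fin 5) := w.flatMap F

/-- `u` is a factor of the fixed point F^ω(0). -/
def FactorF (u : List (Fin 5)) : Prop := ∃ n, u <:+: Fw^[n] [0]

/-- `v` is a conjugate (cyclic rotation) of `u`. -/
def Conj (u v : List (Fin 5)) : Prop := ∃ s t, u = s ++ t ∧ v = t ++ s

/-- The morphism G : Σ* → Δ*, where Δ = {a,b,c,d,e} is coded as
`a = 0, b = 1, c = 2, d = 3, e = 4`. -/
def G : Fin 5 → List (Fin 5)
  | 0 => [0, 1, 2, 3]      -- abcd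
  | 1 => []                -- ε
  | 2 => [4, 0, 2, 3]      -- eacd
  | 3 => [1, 4, 2, 3]      -- becd
  | 4 => [1, 4]            -- be

/-- Extension of G to words. -/
def Gw (w : List (Fin 5)) : List (Fin 5) := w.flatMap G

/-- `u` is a factor of w₅ = G(F^ω(0)). -/
def FactorW5 (u : List (Fin 5)) : Prop := ∃ n, u <:+: Gw (Fw^[n] [0])

/-- The morphism f = F³ on words. -/
def fword (w : List (Fin 5)) : List (Fin 5) := Fw (Fw (Fw w))

/-- The morphism g = G ∘ F² on words. -/
def gword (w : List (Fin 5)) : List (Fin 5) := Gw (Fw (Fw w))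

/-- g(f^k(w)). -/
def gf (k : ℕ) (w : List (Fin 5)) : List (Fin 5) := gword (fword^[k] w)

/-- p = acdbecd · g(24) · g(f(24)) · … · g(f^d(24)). -/
def p0324 (d : ℕ) : List (Fin 5) :=
  [0, 2, 3, 1, 4, 2, 3] ++ ((List.range (d + 1)).map (fun k => gf k [2, 4])).flatten

/-- s = g(f^d(0)) · g(f^{d-1}(01240)) · … · g(01240) · abcdbecde. -/
def s0324 (d : ℕ) : List (Fin 5) :=
  gf d [0] ++
    ((List.range d).reverse.map (fun k => gf k [0, 1, 2, 4, 0])).flatten ++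
    [0, 1, 2, 3, 1, 4, 2, 3, 4]

/-- A morphism whose letter images are distinct and carry the two-letter word `xy` as a prefix and
nowhere else, so that the occurrences of `xy` in an image mark the block boundaries. -/
structure Marked (h : Fin 5 → List (Fin 5)) (x y : Fin 5) : Prop where
  ne : x ≠ y
  pre : ∀ c, [x, y] <+: h c
  tail : ∀ c, ¬ [x, y] <:+: (h c).tail
  inj : Function.Injective h

namespace Marked

variable {h : Fin 5 → List (Fin 5)} {x y : Fin 5}

theorem flatMap_eq_nil_or (H : Marked h x y) (W : List (Fin 5)) :
    W.flatMap h = [] ∨ ∃ Z, W.flatMap h = x :: y :: Z := by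
  rcases W with _ | ⟨c, W⟩
  · simp
  · obtain ⟨t, ht⟩ := H.pre c
    right
    exact ⟨t ++ W.flatMap h, by simp [← ht]⟩

theorem append_ne (H : Marked h x y) {c : Fin 5} {A B W Z : List (Fin 5)} (hc : h c = A ++ B)
    (hA : A ≠ []) (hB : B ≠ []) : B ++ W.flatMap h ≠ x :: y :: Z := by
  intro e
  have hne := H.ne
  have ht := H.tail c
  obtain ⟨a, A, rfl⟩ := List.exists_cons_of_ne_nil hA
  rcases B with _ | ⟨b, _ | ⟨b', B⟩⟩
  · exact hB rfl
  · rcases H.flatMap_eq_nil_or W with h0 | ⟨Z', h0⟩ <;> simp_all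
  · simp only [List.cons_append, List.cons.injEq] at e
    obtain ⟨rfl, rfl, -⟩ := e
    exact ht ⟨A, B, by simp [hc]⟩

theorem exists_split (H : Marked h x y) {W X Z : List (Fin 5)}
    (e : W.flatMap h = X ++ x :: y :: Z) :
    ∃ W₁ W₂, W = W₁ ++ W₂ ∧ W₁.flatMap h = X ∧ W₂.flatMap h = x :: y :: Z := by
  induction W generalizing X with
  | nil => simp at e
  | cons c W ih =>
    rw [List.flatMap_cons, List.append_eq_append_iff] at e
    rcases e with ⟨X', rfl, e⟩ | ⟨B, hc, e⟩
    · obtain ⟨W₁, W₂, rfl, rfl, e₂⟩ := ih e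
      exact ⟨c :: W₁, W₂, by simp, by simp, e₂⟩
    · by_cases hX : X = []
      · subst hX
        exact ⟨[], c :: W, rfl, rfl, by rw [List.flatMap_cons, e, hc, List.nil_append]⟩
      by_cases hB : B = []
      · subst hB
        obtain ⟨W₁, W₂, rfl, e₁, e₂⟩ := ih (X := []) (by simpa using e.symm)
        exact ⟨c :: W₁, W₂, rfl, by rw [List.flatMap_cons, e₁, hc]; simp, e₂⟩
      · exact absurd e.symm (H.append_ne hc hX hB)

theorem eq_of_append (H : Marked h x y) {c c' : Fin 5} {A W V : List (Fin 5)}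
    (hc : h c = h c' ++ A) (e : W.flatMap h = A ++ V.flatMap h) : A = [] := by
  by_contra hA
  have hc' : h c' ≠ [] := by
    obtain ⟨t, ht⟩ := H.pre c'
    simp [← ht]
  rcases H.flatMap_eq_nil_or W with h0 | ⟨Z, h0⟩
  · simp_all
  · exact H.append_ne hc hc' hA (e ▸ h0)

theorem flatMap_injective (H : Marked h x y) :
    Function.Injective fun W : List (Fin 5) => W.flatMap h := by
  have hne (c : Fin 5) : h c ≠ [] := by
    obtain ⟨t, ht⟩ := H.pre c
    simp [← ht]
  intro U V e
  simp only at e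
  induction U generalizing V with
  | nil =>
    rcases V with _ | ⟨c, V⟩
    · rfl
    · simp [hne] at e
  | cons c U ih =>
    rcases V with _ | ⟨c', V⟩
    · simp [hne] at e
    · rw [List.flatMap_cons, List.flatMap_cons, List.append_eq_append_iff] at e
      rcases e with ⟨A, hc, e⟩ | ⟨A, hc, e⟩
      all_goals
        obtain rfl := H.eq_of_append hc e
        simp only [List.append_nil, List.nil_append] at hc e
        obtain rfl := H.inj hc
        first | rw [ih e] | rw [ih e.symm]

/-- Desubstitution: an occurrence of the image of a nonempty word `U` that is followed by the
marker comes from an occurrence of `U`. -/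
theorem exists_desubst (H : Marked h x y) {W X U Z : List (Fin 5)} (hU : U ≠ [])
    (e : X ++ (U.flatMap h ++ x :: y :: Z) = W.flatMap h) :
    ∃ W₁ W₂, W = W₁ ++ U ++ W₂ ∧ W₁.flatMap h = X ∧ W₂.flatMap h = x :: y :: Z := by
  obtain ⟨V, W₂, rfl, e₁, e₂⟩ := H.exists_split (W := W) (X := X ++ U.flatMap h) (Z := Z)
    (by simp [← e])
  have hU' : ∃ Z', U.flatMap h = x :: y :: Z' := by
    obtain ⟨c, U, rfl⟩ := List.exists_cons_of_ne_nil hU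
    obtain ⟨t, ht⟩ := H.pre c
    exact ⟨t ++ U.flatMap h, by simp [← ht]⟩
  obtain ⟨Z', hZ'⟩ := hU'
  rw [hZ'] at e₁
  obtain ⟨W₁, U', rfl, e₃, e₄⟩ := H.exists_split e₁
  obtain rfl : U' = U := H.flatMap_injective (e₄.trans hZ'.symm)
  exact ⟨W₁, W₂, rfl, e₃, e₂⟩

end Marked

theorem fword_eq_flatMap (w : List (Fin 5)) : fword w = w.flatMap fun c => fword [c] := by
  simp [fword, Fw, List.flatMap_assoc]

theorem gword_eq_flatMap (w : List (Fin 5)) : gword w = w.flatMap fun c => gword [c] := by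
  simp [gword, Gw, Fw, List.flatMap_assoc]

theorem fword_append (u v : List (Fin 5)) : fword (u ++ v) = fword u ++ fword v := by
  simp [fword, Fw]

theorem gword_append (u v : List (Fin 5)) : gword (u ++ v) = gword u ++ gword v := by
  simp [gword, Gw, Fw]

theorem iterate_fword_append (k : ℕ) (u v : List (Fin 5)) :
    fword^[k] (u ++ v) = fword^[k] u ++ fword^[k] v := by
  induction k generalizing u v with
  | zero => rfl
  | succ k ih => simp [Function.iterate_succ_apply, fword_append, ih]

theorem gf_append (k : ℕ) (u v : List (Fin 5)) : gf k (u ++ v) = gf k u ++ gf k v := by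
  simp [gf, iterate_fword_append, gword_append]

theorem gf_succ (k : ℕ) (w : List (Fin 5)) : gf (k + 1) w = gf k (fword w) := by
  simp [gf, Function.iterate_succ_apply]

theorem marked_fword : Marked (fun c => fword [c]) 0 1 where
  ne := by decide
  pre := by decide
  tail := by decide
  inj := by decide

theorem marked_gword : Marked (fun c => gword [c]) 0 1 where
  ne := by decide
  pre := by decide
  tail := by decide
  inj := by decide

/-- The word `24 f(24) ⋯ f^d(24) f^d(0) f^{d-1}(01240) ⋯ 01240`, whose image under `g` is the core
of `p0324 d ++ s0324 d`. -/
def core : ℕ → List (Fin 5)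
  | 0 => [2, 4, 0]
  | d + 1 => [2, 4] ++ fword (core d) ++ [0, 1, 2, 4, 0]

theorem core_ne_nil (d : ℕ) : core d ≠ [] := by
  cases d <;> simp [core]

theorem gf_core (j d : ℕ) :
    gf j (core d) =
      ((List.range (d + 1)).map fun k => gf (j + k) [2, 4]).flatten ++ gf (j + d) [0] ++
        ((List.range d).reverse.map fun k => gf (j + k) [0, 1, 2, 4, 0]).flatten := by
  induction d generalizing j with
  | zero => simp [core, ← gf_append]
  | succ d ih =>
    rw [List.range_succ_eq_map (n := d + 1), List.range_succ_eq_map (n := d), core, gf_append,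
      gf_append, ← gf_succ, ih, List.range_succ_eq_map (n := d)]
    simp [Function.comp_def, Nat.add_right_comm, Nat.add_assoc]

theorem p0324_append_s0324 (d : ℕ) :
    p0324 d ++ s0324 d =
      [0, 2, 3, 1, 4, 2, 3] ++ gword (core d) ++ [0, 1, 2, 3, 1, 4, 2, 3, 4] := by
  have h := gf_core 0 d
  simp only [Nat.zero_add] at h
  change gword (core d) = _ at h
  simp [p0324, s0324, h]

theorem Conj.of_isRotated {u v : List (Fin 5)} (h : u ~r v) : Conj u v := by
  obtain ⟨n, hn, rfl⟩ := List.isRotated_iff_mod.1 h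
  exact ⟨u.take n, u.drop n, by simp, List.rotate_eq_drop_append_take hn⟩

theorem gf_isRotated (k : ℕ) {u v : List (Fin 5)} (h : u ~r v) : gf k u ~r gf k v := by
  obtain ⟨n, hn, rfl⟩ := List.isRotated_iff_mod.1 h
  rw [List.rotate_eq_drop_append_take hn, gf_append]
  nth_rw 1 [← List.take_append_drop n u]
  rw [gf_append]
  exact List.isRotated_append

theorem gf_core_isRotated (j d : ℕ) : gf (j + d) [0, 3, 2, 4] ~r gf j (3 :: core d) := by
  induction d generalizing j with
  | zero => exact gf_isRotated j ⟨1, rfl⟩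
  | succ d ih =>
    have h := ih (j + 1)
    rw [gf_succ] at h
    rw [show j + (d + 1) = j + 1 + d by omega]
    refine h.trans (gf_isRotated j ?_)
    have e₁ : fword (3 :: core d) = [0, 1, 2, 4, 0] ++ (3 :: 2 :: 4 :: fword (core d)) :=
      fword_append [3] (core d)
    have e₂ : 3 :: core (d + 1) = (3 :: 2 :: 4 :: fword (core d)) ++ [0, 1, 2, 4, 0] := by
      simp [core]
    rw [e₁, e₂]
    exact List.isRotated_append

theorem conj_gf_0324 (d : ℕ) : Conj (gf d [0, 3, 2, 4]) (p0324 d ++ s0324 d) := by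
  refine Conj.of_isRotated ?_
  have h := gf_core_isRotated 0 d
  rw [Nat.zero_add] at h
  refine h.trans ?_
  have e : gf 0 (3 :: core d) =
      [0, 1, 2, 3, 1, 4, 2, 3, 4] ++ ([0, 2, 3, 1, 4, 2, 3] ++ gword (core d)) :=
    gword_append [3] (core d)
  rw [e, p0324_append_s0324]
  exact List.isRotated_append

theorem fword_eq_nil_or (W : List (Fin 5)) : fword W = [] ∨ ∃ Z, fword W = 0 :: 1 :: Z := by
  rw [fword_eq_flatMap]
  exact marked_fword.flatMap_eq_nil_or W

theorem gword_eq_nil_or (W : List (Fin 5)) : gword W = [] ∨ ∃ Z, gword W = 0 :: 1 :: Z := by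
  rw [gword_eq_flatMap]
  exact marked_gword.flatMap_eq_nil_or W

theorem not_32404_infix_fword {y : Fin 5} (hy : y = 3 ∨ y = 4) (W : List (Fin 5)) :
    ¬ [3, 2, 4, 0, y] <:+: fword W := by
  induction W with
  | nil => simp [fword, Fw]
  | cons c W ih =>
    rw [← List.singleton_append (l := W), fword_append]
    rcases fword_eq_nil_or W with h | ⟨Z, h⟩ <;> rw [h] at ih ⊢ <;> fin_cases c <;>
      rcases hy with rfl | rfl <;>
      simp_all [fword, Fw, F, List.infix_cons_iff]

theorem eq_append_of_fword_suffix {W X : List (Fin 5)} (h : fword W = X ++ [3, 2, 4]) :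
    ∃ V, W = V ++ [3] := by
  rcases List.eq_nil_or_concat W with rfl | ⟨V, c, rfl⟩
  · simp [fword, Fw] at h
  · refine ⟨V, ?_⟩
    have h' := congrArg List.reverse h
    rw [List.concat_eq_append, fword_append, List.reverse_append, List.reverse_append] at h'
    clear h
    generalize fword V = L at h'
    fin_cases c <;> simp [fword, Fw, F] at h' ⊢

theorem eq_append_of_gword_suffix {W X : List (Fin 5)}
    (h : gword W = X ++ [0, 2, 3, 1, 4, 2, 3]) : ∃ V, W = V ++ [3] := by
  rcases List.eq_nil_or_concat W with rfl | ⟨V, c, rfl⟩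
  · simp [gword, Gw, Fw] at h
  · refine ⟨V, ?_⟩
    have h' := congrArg List.reverse h
    rw [List.concat_eq_append, gword_append, List.reverse_append, List.reverse_append] at h'
    clear h
    generalize gword V = L at h'
    fin_cases c <;> simp [gword, Gw, G, Fw, F] at h' ⊢

theorem eq_cons_of_fword_prefix {W Y : List (Fin 5)} {y : Fin 5} (hy : y = 3 ∨ y = 4)
    (h : fword W = 0 :: 1 :: ([2, 4, 0, y] ++ Y)) : ∃ z V, (z = 3 ∨ z = 4) ∧ W = z :: V := by
  rcases W with _ | ⟨c, W⟩
  · simp [fword, Fw] at h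
  · refine ⟨c, W, ?_, rfl⟩
    rw [← List.singleton_append (l := W), fword_append] at h
    rcases fword_eq_nil_or W with h' | ⟨Z, h'⟩ <;> rw [h'] at h <;> fin_cases c <;>
      rcases hy with rfl | rfl <;> simp_all [fword, Fw, F]

theorem eq_cons_of_gword_prefix {W Y : List (Fin 5)}
    (h : gword W = 0 :: 1 :: ([2, 3, 1, 4, 2, 3, 4] ++ Y)) :
    ∃ z V, (z = 3 ∨ z = 4) ∧ W = z :: V := by
  rcases W with _ | ⟨c, W⟩
  · simp [gword, Gw, Fw] at h
  · refine ⟨c, W, ?_, rfl⟩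
    rw [← List.singleton_append (l := W), gword_append] at h
    rcases gword_eq_nil_or W with h' | ⟨Z, h'⟩ <;> rw [h'] at h <;> fin_cases c <;>
      simp_all [gword, Gw, G, Fw, F]

theorem not_core_infix_iterate (d m : ℕ) {y : Fin 5} (hy : y = 3 ∨ y = 4) :
    ¬ [3] ++ core d ++ [y] <:+: fword^[m] [0] := by
  induction d generalizing m y with
  | zero =>
    cases m with
    | zero => intro h; simpa [core] using h.length_le
    | succ m =>
      rw [Function.iterate_succ_apply']
      exact not_32404_infix_fword hy _
  | succ d ih =>
    cases m with
    | zero => intro h; simpa [core] using h.length_le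
    | succ m =>
      rw [Function.iterate_succ_apply']
      rintro ⟨X, Y, e⟩
      rw [fword_eq_flatMap (fword^[m] [0])] at e
      obtain ⟨W₁, W₂, e₀, e₁, e₂⟩ := marked_fword.exists_desubst (core_ne_nil d)
        (X := X ++ [3, 2, 4]) (Z := [2, 4, 0, y] ++ Y)
        (by rw [← e, ← fword_eq_flatMap]; simp [core])
      rw [← fword_eq_flatMap] at e₁ e₂
      obtain ⟨V₁, rfl⟩ := eq_append_of_fword_suffix e₁
      obtain ⟨z, V₂, hz, rfl⟩ := eq_cons_of_fword_prefix hy e₂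
      exact ih m hz ⟨V₁, V₂, by simp [e₀]⟩

theorem iterate_Fw_append (k : ℕ) (u v : List (Fin 5)) :
    Fw^[k] (u ++ v) = Fw^[k] u ++ Fw^[k] v := by
  induction k generalizing u v with
  | zero => rfl
  | succ k ih => rw [Function.iterate_succ_apply, show Fw (u ++ v) = Fw u ++ Fw v by simp [Fw], ih,
      ← Function.iterate_succ_apply, ← Function.iterate_succ_apply]

theorem iterate_Fw_prefix_succ (n : ℕ) : Fw^[n] [0] <+: Fw^[n + 1] [0] :=
  ⟨Fw^[n] [1], by rw [← iterate_Fw_append, Function.iterate_succ_apply]; rfl⟩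

theorem iterate_Fw_prefix_of_le {m n : ℕ} (h : m ≤ n) : Fw^[m] [0] <+: Fw^[n] [0] := by
  induction n, h using Nat.le_induction with
  | base => exact List.prefix_refl _
  | succ n _ ih => exact ih.trans (iterate_Fw_prefix_succ n)

theorem FactorW5.exists_infix_gword {u : List (Fin 5)} (h : FactorW5 u) :
    ∃ m, u <:+: gword (fword^[m] [0]) := by
  obtain ⟨n, hn⟩ := h
  obtain ⟨V, hV⟩ := iterate_Fw_prefix_of_le (show n ≤ 2 + 3 * n by omega)
  have hf : fword = Fw^[3] := rfl
  have hg : gword (fword^[n] [0]) = Gw (Fw^[2 + 3 * n] [0]) := by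
    rw [hf, ← Function.iterate_mul, Function.iterate_add_apply]
    rfl
  refine ⟨n, hn.trans ?_⟩
  rw [hg, ← hV]
  exact (List.prefix_append (Gw _) (Gw V)).isInfix.trans (by simp [Gw])

theorem conj_gf_0324_not_factor (d : ℕ) :
    Conj (gf d [0, 3, 2, 4]) (p0324 d ++ s0324 d) ∧
    ¬ FactorW5 (p0324 d ++ s0324 d) := by
  refine ⟨conj_gf_0324 d, fun h => ?_⟩
  obtain ⟨m, X, Y, e⟩ := h.exists_infix_gword
  rw [p0324_append_s0324, gword_eq_flatMap (fword^[m] [0])] at e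
  obtain ⟨W₁, W₂, e₀, e₁, e₂⟩ := marked_gword.exists_desubst (core_ne_nil d)
    (X := X ++ [0, 2, 3, 1, 4, 2, 3]) (Z := [2, 3, 1, 4, 2, 3, 4] ++ Y)
    (by rw [← e, ← gword_eq_flatMap]; simp)
  rw [← gword_eq_flatMap] at e₁ e₂
  obtain ⟨V₁, rfl⟩ := eq_append_of_gword_suffix e₁
  obtain ⟨z, V₂, hz, rfl⟩ := eq_cons_of_gword_prefix e₂
  exact not_core_infix_iterate d m hz ⟨V₁, V₂, by simp [e₀]⟩
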